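/- arXiv:2412.01544 — 2 statements merged into one kernel-verified Lean document; each statement's English description precedes it below -/
import Mathlib

section
/- Let -1 < k < 3/2 and c_k := 4π√2 ∫₀¹ η^k √(1-η) dη. For ρ ∈ D define T(ρ)(r) := A(ρ) · c_k · max(-1 - U_ρ(r), 0)^{k+3/2}, where A(ρ) := ( c_k · 4π ∫₀¹ r² max(-1 - U_ρ(r), 0)^{k+3/2} dr )^{-1}. Then T(ρ) ∈ D, i.e. T(ρ) is nonnegative, nonincreasing on (0,1], vanishes for r > 1, and satisfies 4π ∫₀¹ r² T(ρ)(r) dr = 1. -/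
open MeasureTheory Real

noncomputable section

/-- The set `D`: nonnegative, measurable, nonincreasing on `(0,1]`,
vanishing for `r > 1`, with mass one. -/
def memD (ρ : ℝ → ℝ) : Prop :=
  Measurable ρ ∧ (∀ r : ℝ, 0 ≤ ρ r) ∧
  (∀ r s : ℝ, 0 < r → r ≤ s → s ≤ 1 → ρ s ≤ ρ r) ∧
  (∀ r : ℝ, 1 < r → ρ r = 0) ∧
  4 * π * (∫ r in (0:ℝ)..1, r ^ 2 * ρ r) = 1

/-- The gravitational potential induced by the spherically symmetric density `ρ`. -/
def U (ρ : ℝ → ℝ) (r : ℝ) : ℝ :=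
  -(4 * π / r) * (∫ s in (0:ℝ)..r, s ^ 2 * ρ s) - 4 * π * (∫ s in r..1, s * ρ s)
/-- The constant `c_k = 4π√2 ∫₀¹ η^k √(1-η) dη`. -/
def ck (k : ℝ) : ℝ := 4 * π * Real.sqrt 2 * ∫ η in (0:ℝ)..1, η ^ k * Real.sqrt (1 - η)

/-- The normalising amplitude `A(ρ) = (c_k · 4π ∫₀¹ r² (-1-U_ρ(r))₊^{k+3/2} dr)⁻¹`. -/
def Amp (k : ℝ) (ρ : ℝ → ℝ) : ℝ :=
  (ck k * (4 * π * ∫ r in (0:ℝ)..1, r ^ 2 * (max (-1 - U ρ r) 0) ^ (k + 3/2)))⁻¹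

/-- The mass-preserving map `T(ρ)(r) = A(ρ) c_k (-1 - U_ρ(r))₊^{k+3/2}`. -/
def Tmap (k : ℝ) (ρ : ℝ → ℝ) (r : ℝ) : ℝ :=
  Amp k ρ * ck k * (max (-1 - U ρ r) 0) ^ (k + 3/2)

lemma meas_prim (f : ℝ → ℝ) (hf : Measurable f) (a : ℝ) :
    Measurable (fun r : ℝ => ∫ s in a..r, f s) := by
  have key : ∀ S : Set (ℝ × ℝ), MeasurableSet S →
      Measurable (fun r : ℝ => ∫ s, S.indicator (fun p => f p.2) (r, s)) := by
    intro S hS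
    have h : StronglyMeasurable (S.indicator (fun p : ℝ × ℝ => f p.2)) :=
      ((hf.comp measurable_snd).indicator hS).stronglyMeasurable
    exact (h.integral_prod_right' (ν := volume)).measurable
  have h1 := key {p | a < p.2 ∧ p.2 ≤ p.1}
    ((measurableSet_lt measurable_const measurable_snd).inter
      (measurableSet_le measurable_snd measurable_fst))
  have h2 := key {p | p.1 < p.2 ∧ p.2 ≤ a}
    ((measurableSet_lt measurable_fst measurable_snd).inter
      (measurableSet_le measurable_snd measurable_const))
  have := h1.sub h2
  convert this using 2 with r
  rw [intervalIntegral, ← integral_indicator measurableSet_Ioc,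
    ← integral_indicator measurableSet_Ioc]
  rfl

lemma meas_U (ρ : ℝ → ℝ) (h : Measurable ρ) : Measurable (U ρ) := by
  have h1 := meas_prim (fun s => s ^ 2 * ρ s) (by fun_prop) 0
  have h2 := meas_prim (fun s => s * ρ s) (by fun_prop) 1
  have h3 : Measurable (fun r : ℝ => ∫ s in r..1, s * ρ s) := by
    have := h2.neg
    convert this using 2 with r
    exact intervalIntegral.integral_symm _ _
  unfold U
  exact ((measurable_const.div measurable_id).neg.mul h1).sub (measurable_const.mul h3)

lemma memD.int {ρ : ℝ → ℝ} (h : memD ρ) :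
    IntervalIntegrable (fun s => s ^ 2 * ρ s) volume 0 1 := by
  by_contra hc
  have := h.2.2.2.2
  rw [intervalIntegral.integral_undef hc] at this
  simp at this

lemma ker_int {ρ : ℝ → ℝ} (h : memD ρ) {r : ℝ} (hr : 0 < r) :
    IntervalIntegrable (fun s => s ^ 2 * ρ s * (1 / max r s)) volume 0 1 := by
  apply h.int.mul_continuousOn
  apply Continuous.continuousOn
  exact continuous_const.div (by fun_prop) (fun s => (lt_of_lt_of_le hr (le_max_left _ _)).ne')

lemma U_eq {ρ : ℝ → ℝ} (h : memD ρ) {r : ℝ} (hr : 0 < r) (hr1 : r ≤ 1) :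
    -U ρ r = 4 * π * ∫ s in (0:ℝ)..1, s ^ 2 * ρ s * (1 / max r s) := by
  have hi := ker_int h hr
  have hrm : r ∈ Set.uIcc (0:ℝ) 1 := by rw [Set.uIcc_of_le zero_le_one]; exact ⟨hr.le, hr1⟩
  have i1 := hi.mono_set (Set.uIcc_subset_uIcc Set.left_mem_uIcc hrm)
  have i2 := hi.mono_set (Set.uIcc_subset_uIcc hrm Set.right_mem_uIcc)
  rw [← intervalIntegral.integral_add_adjacent_intervals i1 i2]
  have e1 : ∫ s in (0:ℝ)..r, s ^ 2 * ρ s * (1 / max r s)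
      = (∫ s in (0:ℝ)..r, s ^ 2 * ρ s) * (1 / r) := by
    rw [← intervalIntegral.integral_mul_const]
    apply intervalIntegral.integral_congr
    intro s hs
    rw [Set.uIcc_of_le hr.le] at hs
    simp only [max_eq_left hs.2]
  have e2 : ∫ s in r..1, s ^ 2 * ρ s * (1 / max r s) = ∫ s in r..1, s * ρ s := by
    apply intervalIntegral.integral_congr
    intro s hs
    rw [Set.uIcc_of_le hr1] at hs
    have : s ≠ 0 := (hr.trans_le hs.1).ne'
    simp only [max_eq_right hs.1]
    field_simp
  rw [e1, e2, U]
  ring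

lemma U_gt {ρ : ℝ → ℝ} (h : memD ρ) {r : ℝ} (hr : 1 < r) : -U ρ r = 1 / r := by
  have e2 : ∫ s in r..1, s * ρ s = 0 := by
    rw [intervalIntegral.integral_symm, intervalIntegral.integral_of_le hr.le,
      setIntegral_congr_fun (g := fun _ => (0:ℝ)) measurableSet_Ioc]
    · simp
    · intro s hs
      simp [h.2.2.2.1 s hs.1]
  have e1 : ∫ s in (0:ℝ)..r, s ^ 2 * ρ s = ∫ s in (0:ℝ)..1, s ^ 2 * ρ s := by
    have hz : Set.EqOn (fun s => s ^ 2 * ρ s) (fun _ => (0:ℝ)) (Set.Ioc 1 r) := by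
      intro s hs
      simp [h.2.2.2.1 s hs.1]
    have i2 : IntervalIntegrable (fun s => s ^ 2 * ρ s) volume 1 r := by
      rw [intervalIntegrable_iff_integrableOn_Ioc_of_le hr.le,
        integrableOn_congr_fun hz measurableSet_Ioc]
      simp
    rw [← intervalIntegral.integral_add_adjacent_intervals h.int i2,
      intervalIntegral.integral_of_le hr.le, setIntegral_congr_fun measurableSet_Ioc hz]
    simp
  have := h.2.2.2.2
  rw [U, e1, e2]
  calc _ = (4 * π * ∫ s in (0:ℝ)..1, s ^ 2 * ρ s) / r := by ring
    _ = _ := by rw [this]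

lemma U_anti {ρ : ℝ → ℝ} (h : memD ρ) {r s : ℝ} (hr : 0 < r) (hrs : r ≤ s) (hs : s ≤ 1) :
    -U ρ s ≤ -U ρ r := by
  rw [U_eq h hr (hrs.trans hs), U_eq h (hr.trans_le hrs) hs]
  apply mul_le_mul_of_nonneg_left _ (by positivity)
  apply intervalIntegral.integral_mono_on zero_le_one (ker_int h (hr.trans_le hrs)) (ker_int h hr)
  intro x _
  apply mul_le_mul_of_nonneg_left _ (mul_nonneg (sq_nonneg _) (h.2.1 x))
  apply one_div_le_one_div_of_le (lt_of_lt_of_le hr (le_max_left _ _))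
  exact max_le_max hrs le_rfl

lemma U_bound {ρ : ℝ → ℝ} (h : memD ρ) {r : ℝ} (hr : 0 < r) (hr1 : r ≤ 1) :
    -U ρ r ≤ 1 / r := by
  rw [U_eq h hr hr1]
  have : ∫ s in (0:ℝ)..1, s ^ 2 * ρ s * (1 / max r s)
      ≤ ∫ s in (0:ℝ)..1, s ^ 2 * ρ s * (1 / r) := by
    apply intervalIntegral.integral_mono_on zero_le_one (ker_int h hr) (h.int.mul_const _)
    intro x _
    apply mul_le_mul_of_nonneg_left _ (mul_nonneg (sq_nonneg _) (h.2.1 x))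
    exact one_div_le_one_div_of_le hr (le_max_left _ _)
  rw [intervalIntegral.integral_mul_const] at this
  calc _ ≤ 4 * π * ((∫ s in (0:ℝ)..1, s ^ 2 * ρ s) * (1 / r)) :=
        mul_le_mul_of_nonneg_left this (by positivity)
    _ = (4 * π * (∫ s in (0:ℝ)..1, s ^ 2 * ρ s)) * (1 / r) := by ring
    _ = _ := by rw [h.2.2.2.2, one_mul]

lemma U_pos {ρ : ℝ → ℝ} (h : memD ρ) {r : ℝ} (hr : 0 < r) (hr1 : r < 1) :
    0 < -1 - U ρ r := by
  have hm := h.2.2.2.2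
  have e : -1 - U ρ r
      = 4 * π * ∫ s in (0:ℝ)..1, (s ^ 2 * ρ s * (1 / max r s) - s ^ 2 * ρ s) := by
    rw [intervalIntegral.integral_sub (ker_int h hr) h.int, mul_sub, hm, ← U_eq h hr hr1.le]
    ring
  rw [e]
  apply mul_pos (by positivity)
  have hi := (ker_int h hr).sub h.int
  have hpt : ∀ s ∈ Set.Ioc (0:ℝ) 1, 1 ≤ 1 / max r s := by
    intro s hs
    rw [le_div_iff₀ (lt_of_lt_of_le hr (le_max_left _ _)), one_mul]
    exact max_le hr1.le hs.2
  have hnn : 0 ≤ᵐ[volume.restrict (Set.Ioc (0:ℝ) 1)]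
      (fun s => s ^ 2 * ρ s * (1 / max r s) - s ^ 2 * ρ s) := by
    filter_upwards [ae_restrict_mem measurableSet_Ioc] with s hs
    have h1 := hpt s hs
    have h2 : 0 ≤ s ^ 2 * ρ s := mul_nonneg (sq_nonneg _) (h.2.1 s)
    simp only [Pi.zero_apply]
    nlinarith
  rw [intervalIntegral.integral_of_le zero_le_one]
  refine lt_of_le_of_ne (integral_nonneg_of_ae hnn) (fun h0 => ?_)
  have hz := (integral_eq_zero_iff_of_nonneg_ae hnn
    ((intervalIntegrable_iff_integrableOn_Ioc_of_le zero_le_one).1 hi)).1 h0.symm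
  have hne : ∀ᵐ s ∂(volume.restrict (Set.Ioc (0:ℝ) 1)), s ≠ 1 :=
    ae_restrict_of_ae (Measure.ae_ne volume 1)
  have hz2 : (fun s => s ^ 2 * ρ s) =ᵐ[volume.restrict (Set.Ioc (0:ℝ) 1)] (fun _ => (0:ℝ)) := by
    filter_upwards [ae_restrict_mem measurableSet_Ioc, hz, hne] with s hs hs2 hs3
    have hlt : max r s < 1 := max_lt hr1 (lt_of_le_of_ne hs.2 hs3)
    have h1 : 1 < 1 / max r s := by
      rwa [lt_div_iff₀ (lt_of_lt_of_le hr (le_max_left _ _)), one_mul]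
    simp only [Pi.zero_apply] at hs2
    have h2 : s ^ 2 * ρ s * (1 / max r s - 1) = 0 := by linarith
    rcases mul_eq_zero.1 h2 with h3 | h3
    · exact h3
    · linarith
  rw [intervalIntegral.integral_of_le zero_le_one, integral_congr_ae hz2] at hm
  simp at hm

lemma ck_pos {k : ℝ} (hk : -1 < k) : 0 < ck k := by
  unfold ck
  refine mul_pos (by positivity) ?_
  apply intervalIntegral.intervalIntegral_pos_of_pos_on
  · exact (intervalIntegral.intervalIntegrable_rpow' hk).mul_continuousOn (by fun_prop)
  · intro x hx
    exact mul_pos (Real.rpow_pos_of_pos hx.1 _) (Real.sqrt_pos.2 (by linarith [hx.2]))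
  · exact zero_lt_one

lemma mass_pos {k : ℝ} (hk : -1 < k) (hk' : k < 3/2) {ρ : ℝ → ℝ} (h : memD ρ) :
    0 < ∫ r in (0:ℝ)..1, r ^ 2 * (max (-1 - U ρ r) 0) ^ (k + 3/2) := by
  apply intervalIntegral.intervalIntegral_pos_of_pos_on
  · have hdom : IntervalIntegrable (fun r : ℝ => r ^ (2 - (k + 3/2))) volume 0 1 :=
      intervalIntegral.intervalIntegrable_rpow' (by linarith)
    refine hdom.mono_fun' ?_ ?_
    · have := meas_U ρ h.1
      exact Measurable.aestronglyMeasurable (by fun_prop)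
    · rw [Set.uIoc_of_le zero_le_one]
      filter_upwards [ae_restrict_mem measurableSet_Ioc] with r hr
      have hb := U_bound h hr.1 hr.2
      have hp : (0:ℝ) < 1 / r := one_div_pos.2 hr.1
      have h1 : max (-1 - U ρ r) 0 ≤ 1 / r := max_le (by linarith) hp.le
      have h2 : (max (-1 - U ρ r) 0) ^ (k + 3/2) ≤ (1 / r) ^ (k + 3/2) :=
        Real.rpow_le_rpow (le_max_right _ _) h1 (by linarith)
      rw [Real.norm_of_nonneg (mul_nonneg (sq_nonneg _)
        (Real.rpow_nonneg (le_max_right _ _) _))]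
      calc _ ≤ r ^ 2 * (1 / r) ^ (k + 3/2) := mul_le_mul_of_nonneg_left h2 (sq_nonneg _)
        _ = _ := by
          rw [Real.rpow_sub hr.1, one_div, Real.inv_rpow hr.1.le, Real.rpow_two]
          rfl
  · intro x hx
    have := U_pos h hx.1 hx.2
    exact mul_pos (pow_pos hx.1 2) (Real.rpow_pos_of_pos (lt_max_of_lt_left this) _)
  · exact zero_lt_one

/-- For `-1 < k < 3/2` and every `ρ ∈ D` one has `T(ρ) ∈ D`: it is nonnegative,
nonincreasing on `(0,1]`, vanishes for `r > 1`, and has mass one. -/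
theorem stmt_12 (k : ℝ) (hk : -1 < k) (hk' : k < 3/2) (ρ : ℝ → ℝ) (hρ : memD ρ) :
    memD (Tmap k ρ) := by
  have hc := ck_pos hk
  have hm := mass_pos hk hk' hρ
  have hA : 0 < Amp k ρ := by unfold Amp; positivity
  refine ⟨?_, ?_, ?_, ?_, ?_⟩
  · have := meas_U ρ hρ.1
    unfold Tmap
    fun_prop
  · intro r
    exact mul_nonneg (by positivity) (Real.rpow_nonneg (le_max_right _ _) _)
  · intro r s hr hrs hs
    refine mul_le_mul_of_nonneg_left ?_ (by positivity)
    apply Real.rpow_le_rpow (le_max_right _ _) _ (by linarith)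
    have := U_anti hρ hr hrs hs
    exact max_le_max (by linarith) le_rfl
  · intro r hr
    have h1 := U_gt hρ hr
    have h2 : 1 / r < 1 := by rw [div_lt_one (by linarith)]; exact hr
    rw [Tmap, max_eq_right (by linarith), Real.zero_rpow (by linarith), mul_zero]
  · have e : ∀ r, r ^ 2 * Tmap k ρ r
        = (Amp k ρ * ck k) * (r ^ 2 * (max (-1 - U ρ r) 0) ^ (k + 3/2)) := by
      intro r; rw [Tmap]; ring
    simp only [e]
    rw [intervalIntegral.integral_const_mul, Amp]
    have := Real.pi_pos
    generalize (∫ r in (0:ℝ)..1, r ^ 2 * (max (-1 - U ρ r) 0) ^ (k + 3/2)) = I at hm ⊢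
    field_simp
end
end

section
/- Let -1 < k < 1/2 and let 3/2 < p < 3/(k + 3/2). Then there is a constant C > 0 such that for every ρ ∈ D, the function T(ρ), viewed as the radial profile of the spherically symmetric function x ↦ T(ρ)(|x|) on the unit ball B ⊂ ℝ³, satisfies ‖T(ρ)‖_{L^p(B)} ≤ C; equivalently, 4π ∫₀¹ r² T(ρ)(r)^p dr ≤ C^p. -/
open MeasureTheory Real

noncomputable section

lemma memD_int {ρ : ℝ → ℝ} (h : memD ρ) :
    IntegrableOn (fun s => s ^ 2 * ρ s) (Set.Ioc 0 1) := by
  obtain ⟨_, _, _, _, h5⟩ := h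
  by_contra hc
  rw [intervalIntegral.integral_of_le zero_le_one, integral_undef hc] at h5
  simp at h5

lemma memD_ii {ρ : ℝ → ℝ} (h : memD ρ) {a b : ℝ} (ha : 0 ≤ a) (hab : a ≤ b) (hb : b ≤ 1) :
    IntervalIntegrable (fun s => s ^ 2 * ρ s) volume a b := by
  rw [intervalIntegrable_iff_integrableOn_Ioc_of_le hab]
  exact (memD_int h).mono_set (Set.Ioc_subset_Ioc ha hb)

lemma memD_ii1 {ρ : ℝ → ℝ} (h : memD ρ) {a b : ℝ} (ha : 0 < a) (hab : a ≤ b) (hb : b ≤ 1) :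
    IntervalIntegrable (fun s => s * ρ s) volume a b := by
  rw [intervalIntegrable_iff_integrableOn_Ioc_of_le hab]
  have h2 : IntegrableOn (fun s => a⁻¹ * (s ^ 2 * ρ s)) (Set.Ioc a b) :=
    ((memD_int h).mono_set (Set.Ioc_subset_Ioc ha.le hb)).const_mul _
  refine Integrable.mono' h2 (measurable_id.mul h.1).aestronglyMeasurable ?_
  filter_upwards [ae_restrict_mem measurableSet_Ioc] with s hs
  have hs0 : 0 < s := ha.trans hs.1
  have hr := h.2.1 s
  rw [Real.norm_of_nonneg (mul_nonneg hs0.le hr), inv_mul_eq_div, le_div_iff₀ ha]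
  nlinarith [mul_nonneg (mul_nonneg hs0.le hr) (sub_nonneg.2 hs.1.le)]

lemma U_upper {ρ : ℝ → ℝ} (h : memD ρ) {r : ℝ} (hr : 0 < r) (hr1 : r ≤ 1) :
    max (-1 - U ρ r) 0 ≤ r⁻¹ := by
  have e := intervalIntegral.integral_add_adjacent_intervals (memD_ii h le_rfl hr.le hr1)
    (memD_ii h hr.le hr1 le_rfl)
  have h5 := h.2.2.2.2
  have hle : (∫ s in r..1, s * ρ s) ≤ ∫ s in r..1, r⁻¹ * (s ^ 2 * ρ s) := by
    refine intervalIntegral.integral_mono_on hr1 (memD_ii1 h hr hr1 le_rfl)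
      ((memD_ii h hr.le hr1 le_rfl).const_mul _) ?_
    intro s hs
    have hs0 : 0 < s := hr.trans_le hs.1
    rw [inv_mul_eq_div, le_div_iff₀ hr]
    nlinarith [mul_nonneg (mul_nonneg hs0.le (h.2.1 s)) (sub_nonneg.2 hs.1)]
  rw [intervalIntegral.integral_const_mul] at hle
  refine max_le ?_ (inv_nonneg.2 hr.le)
  unfold U
  rw [← e] at h5
  have h6 : r⁻¹ * (4 * π * ((∫ s in (0:ℝ)..r, s ^ 2 * ρ s) + ∫ s in r..1, s ^ 2 * ρ s)) = r⁻¹ := by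
    rw [h5, mul_one]
  have h7 := mul_le_mul_of_nonneg_left hle (by positivity : (0:ℝ) ≤ 4 * π)
  rw [div_eq_mul_inv]
  nlinarith

lemma half_mass {ρ : ℝ → ℝ} (h : memD ρ) :
    1 / 8 ≤ 4 * π * ∫ s in (0:ℝ)..(1/2), s ^ 2 * ρ s := by
  have e := intervalIntegral.integral_add_adjacent_intervals
    (memD_ii h le_rfl (by norm_num : (0:ℝ) ≤ 1/2) (by norm_num))
    (memD_ii h (by norm_num : (0:ℝ) ≤ 1/2) (by norm_num) le_rfl)
  have h5 := h.2.2.2.2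
  have hc : Continuous (fun s : ℝ => s ^ 2 * ρ (1/2)) := by fun_prop
  have l1 : (∫ s in (0:ℝ)..(1/2), s ^ 2 * ρ (1/2)) ≤ ∫ s in (0:ℝ)..(1/2), s ^ 2 * ρ s := by
    refine intervalIntegral.integral_mono_on (by norm_num) (hc.intervalIntegrable _ _)
      (memD_ii h le_rfl (by norm_num) (by norm_num)) ?_
    intro s hs
    rcases hs.1.eq_or_lt with h0 | h0
    · simp [← h0]
    · exact mul_le_mul_of_nonneg_left (h.2.2.1 _ _ h0 hs.2 (by norm_num)) (sq_nonneg _)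
  have l2 : (∫ s in (1/2:ℝ)..1, s ^ 2 * ρ s) ≤ ∫ s in (1/2:ℝ)..1, s ^ 2 * ρ (1/2) := by
    refine intervalIntegral.integral_mono_on (by norm_num)
      (memD_ii h (by norm_num) (by norm_num) le_rfl) (hc.intervalIntegrable _ _) ?_
    intro s hs
    exact mul_le_mul_of_nonneg_left (h.2.2.1 _ _ (by norm_num) hs.1 hs.2) (sq_nonneg _)
  rw [intervalIntegral.integral_mul_const, integral_pow] at l1 l2
  norm_num at l1 l2 e
  rw [← e] at h5
  have := Real.pi_pos
  have h8 : (∫ s in (1/2:ℝ)..1, s ^ 2 * ρ s) ≤ 7 * ∫ s in (0:ℝ)..(1/2), s ^ 2 * ρ s := by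
    norm_num
    linarith
  norm_num at h8 ⊢
  nlinarith [mul_le_mul_of_nonneg_left h8 this.le]

lemma U_lower {ρ : ℝ → ℝ} (h : memD ρ) {r : ℝ} (hr : 0 < r) (hr1 : r ≤ 1/2) :
    1 / 8 ≤ max (-1 - U ρ r) 0 := by
  refine le_max_of_le_left ((half_mass h).trans ?_)
  have h5 := h.2.2.2.2
  have i1 := memD_ii h le_rfl hr.le (by linarith)
  have i2 := memD_ii h hr.le hr1 (by norm_num)
  have i3 := memD_ii h (by norm_num : (0:ℝ) ≤ 1/2) (by norm_num) le_rfl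
  have j2 := memD_ii1 h hr hr1 (by norm_num)
  have j3 := memD_ii1 h (by norm_num : (0:ℝ) < 1/2) (by norm_num) le_rfl
  have e0 := intervalIntegral.integral_add_adjacent_intervals i1 i2
  have e1 := intervalIntegral.integral_add_adjacent_intervals (i1.trans i2) i3
  have e2 := intervalIntegral.integral_add_adjacent_intervals j2 j3
  have a1 : 0 ≤ ∫ s in (0:ℝ)..r, s ^ 2 * ρ s :=
    intervalIntegral.integral_nonneg hr.le fun s _ => mul_nonneg (sq_nonneg _) (h.2.1 s)
  have a2 : (∫ s in r..(1/2), 2 * (s ^ 2 * ρ s)) ≤ ∫ s in r..(1/2), s * ρ s := by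
    refine intervalIntegral.integral_mono_on hr1 (i2.const_mul _) j2 ?_
    intro s hs
    have hs0 : 0 < s := hr.trans_le hs.1
    nlinarith [mul_nonneg (mul_nonneg hs0.le (h.2.1 s)) (sub_nonneg.2 hs.2)]
  have a3 : (∫ s in (1/2:ℝ)..1, s ^ 2 * ρ s) ≤ ∫ s in (1/2:ℝ)..1, s * ρ s := by
    refine intervalIntegral.integral_mono_on (by norm_num) i3 j3 ?_
    intro s hs
    have hs0 : 0 < s := by have := hs.1; linarith
    nlinarith [mul_nonneg (mul_nonneg hs0.le (h.2.1 s)) (sub_nonneg.2 hs.2)]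
  rw [intervalIntegral.integral_const_mul] at a2
  have hri : 2 ≤ r⁻¹ := by
    rw [le_inv_comm₀ (by norm_num) hr]; linarith
  unfold U
  rw [← e1, ← e0] at h5
  rw [← e0, ← e2]
  generalize (∫ s in (0:ℝ)..r, s ^ 2 * ρ s) = X at *
  generalize (∫ s in r..(1/2), s ^ 2 * ρ s) = Y at *
  generalize (∫ s in (1/2:ℝ)..1, s ^ 2 * ρ s) = Z at *
  generalize (∫ s in r..(1/2), s * ρ s) = Y' at *
  generalize (∫ s in (1/2:ℝ)..1, s * ρ s) = Z' at *
  have key : X + Y ≤ r⁻¹ * X + Y' + Z' - (X + Y + Z) := by nlinarith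
  have := mul_le_mul_of_nonneg_left key (by positivity : (0:ℝ) ≤ 4 * π)
  rw [div_eq_mul_inv]
  nlinarith

lemma U_aem {ρ : ℝ → ℝ} (h : memD ρ) :
    AEMeasurable (U ρ) (volume.restrict (Set.Ioc 0 1)) := by
  have m1 : MonotoneOn (fun r => ∫ s in (0:ℝ)..r, s ^ 2 * ρ s) (Set.Ioc 0 1) := by
    intro a ha b hb hab
    have e := intervalIntegral.integral_add_adjacent_intervals
      (memD_ii h le_rfl ha.1.le ha.2) (memD_ii h ha.1.le hab hb.2)
    have : 0 ≤ ∫ s in a..b, s ^ 2 * ρ s :=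
      intervalIntegral.integral_nonneg hab fun s _ => mul_nonneg (sq_nonneg _) (h.2.1 s)
    simp only
    linarith
  have m2 : AntitoneOn (fun r => ∫ s in r..1, s * ρ s) (Set.Ioc 0 1) := by
    intro a ha b hb hab
    have e := intervalIntegral.integral_add_adjacent_intervals
      (memD_ii1 h ha.1 hab hb.2) (memD_ii1 h hb.1 hb.2 le_rfl)
    have : 0 ≤ ∫ s in a..b, s * ρ s :=
      intervalIntegral.integral_nonneg hab fun s hs =>
        mul_nonneg (ha.1.le.trans hs.1) (h.2.1 s)
    simp only
    linarith
  have a1 := aemeasurable_restrict_of_monotoneOn (μ := volume) measurableSet_Ioc m1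
  have a2 := aemeasurable_restrict_of_antitoneOn (μ := volume) measurableSet_Ioc m2
  have a3 : Measurable (fun r : ℝ => -(4 * π / r)) := by fun_prop
  exact (a3.aemeasurable.mul a1).sub (a2.const_mul (4 * π))

lemma J_lower {ρ : ℝ → ℝ} (h : memD ρ) {q : ℝ} (hq : 0 < q) (hq2 : q < 3) :
    (1/8 : ℝ) ^ q / 24 ≤ ∫ r in (0:ℝ)..1, r ^ 2 * (max (-1 - U ρ r) 0) ^ q := by
  have hint : IntegrableOn (fun r => r ^ 2 * (max (-1 - U ρ r) 0) ^ q) (Set.Ioc 0 1) := by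
    have hg : IntegrableOn (fun r : ℝ => r ^ (2 - q)) (Set.Ioc 0 1) := by
      rw [← intervalIntegrable_iff_integrableOn_Ioc_of_le zero_le_one]
      exact intervalIntegral.intervalIntegrable_rpow' (by linarith)
    refine Integrable.mono' hg ?_ ?_
    · have hm : Measurable (fun r : ℝ => r ^ 2) := by fun_prop
      exact (hm.aemeasurable.mul ((((U_aem h).const_sub (-1)).max
        aemeasurable_const).pow_const q)).aestronglyMeasurable
    · filter_upwards [ae_restrict_mem measurableSet_Ioc] with r hr
      rw [Real.norm_of_nonneg (by positivity), Real.rpow_sub hr.1, Real.rpow_two, div_eq_mul_inv,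
        ← Real.inv_rpow hr.1.le]
      exact mul_le_mul_of_nonneg_left (Real.rpow_le_rpow (le_max_right _ _)
        (U_upper h hr.1 hr.2) hq.le) (sq_nonneg _)
  have i1 : IntervalIntegrable (fun r => r ^ 2 * (max (-1 - U ρ r) 0) ^ q) volume 0 (1/2) := by
    rw [intervalIntegrable_iff_integrableOn_Ioc_of_le (by norm_num)]
    exact hint.mono_set (Set.Ioc_subset_Ioc le_rfl (by norm_num))
  have i2 : IntervalIntegrable (fun r => r ^ 2 * (max (-1 - U ρ r) 0) ^ q) volume (1/2) 1 := by
    rw [intervalIntegrable_iff_integrableOn_Ioc_of_le (by norm_num)]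
    exact hint.mono_set (Set.Ioc_subset_Ioc (by norm_num) le_rfl)
  have e := intervalIntegral.integral_add_adjacent_intervals i1 i2
  have n2 : 0 ≤ ∫ r in (1/2:ℝ)..1, r ^ 2 * (max (-1 - U ρ r) 0) ^ q :=
    intervalIntegral.integral_nonneg (by norm_num) fun r _ => by positivity
  have hc : Continuous (fun s : ℝ => s ^ 2 * (1/8 : ℝ) ^ q) := by fun_prop
  have l1 : (∫ r in (0:ℝ)..(1/2), r ^ 2 * (1/8 : ℝ) ^ q) ≤
      ∫ r in (0:ℝ)..(1/2), r ^ 2 * (max (-1 - U ρ r) 0) ^ q := by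
    refine intervalIntegral.integral_mono_on (by norm_num) (hc.intervalIntegrable _ _) i1 ?_
    intro r hr
    rcases hr.1.eq_or_lt with h0 | h0
    · simp [← h0]
    · exact mul_le_mul_of_nonneg_left (Real.rpow_le_rpow (by norm_num)
        (U_lower h h0 hr.2) hq.le) (sq_nonneg _)
  rw [intervalIntegral.integral_mul_const, integral_pow] at l1
  have l3 : ((1/2:ℝ)^(2+1) - 0^(2+1))/((2:ℕ)+1 : ℝ) * (1/8 : ℝ)^q = (1/8 : ℝ) ^ q / 24 := by
    norm_num
    ring
  rw [l3] at l1
  linarith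

/-- For `-1 < k < 1/2` and `3/2 < p < 3/(k+3/2)` there exists `C > 0` such that
for every `ρ ∈ D` the spherically symmetric function with radial profile `T(ρ)`
satisfies `‖T(ρ)‖_{L^p(B)} ≤ C`, i.e. `4π ∫₀¹ r² T(ρ)(r)^p dr ≤ C^p`. -/
theorem stmt_13 (k : ℝ) (hk : -1 < k) (hk' : k < 1/2)
    (p : ℝ) (hp : 3/2 < p) (hp' : p < 3 / (k + 3/2)) :
    ∃ C : ℝ, 0 < C ∧ ∀ ρ : ℝ → ℝ, memD ρ →
      4 * π * (∫ r in (0:ℝ)..1, r ^ 2 * (Tmap k ρ r) ^ p) ≤ C ^ p := by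
  set q := k + 3/2 with hqd
  have hq : 0 < q := by rw [hqd]; linarith
  have hq3 : q < 3 := by rw [hqd]; linarith
  have hp0 : 0 < p := by linarith
  have hpq : q * p < 3 := by
    rw [lt_div_iff₀ hq] at hp'
    linarith
  have hck : 0 ≤ ck k := by
    unfold ck
    refine mul_nonneg (by positivity) (intervalIntegral.integral_nonneg zero_le_one ?_)
    intro η hη
    exact mul_nonneg (Real.rpow_nonneg hη.1 _) (Real.sqrt_nonneg _)
  set J0 : ℝ := (1/8 : ℝ) ^ q / 24 with hJ0
  have hJ0p : 0 < J0 := by positivity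
  set B : ℝ := (4 * π * J0)⁻¹ with hB
  have hBp : 0 < B := by positivity
  have hM : 0 < 4 * π * (B ^ p * (3 - q * p)⁻¹) := by
    have : 0 < 3 - q * p := by linarith
    positivity
  refine ⟨(4 * π * (B ^ p * (3 - q * p)⁻¹)) ^ p⁻¹, Real.rpow_pos_of_pos hM _, ?_⟩
  intro ρ h
  rw [Real.rpow_inv_rpow hM.le hp0.ne']
  refine mul_le_mul_of_nonneg_left ?_ (by positivity)
  have hJ := J_lower h hq hq3
  have hJp := hJ0p.trans_le hJ
  have hA0 : 0 ≤ Amp k ρ * ck k := by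
    unfold Amp
    rw [← hqd]
    positivity
  have hA : Amp k ρ * ck k ≤ B := by
    rcases hck.eq_or_lt with h0 | h0
    · rw [← h0, mul_zero]; exact hBp.le
    · unfold Amp
      rw [← hqd, mul_inv, mul_comm (ck k)⁻¹, mul_assoc, inv_mul_cancel₀ h0.ne', mul_one, hB]
      gcongr
  have hI : (∫ r in (0:ℝ)..1, B ^ p * r ^ (2 - q * p)) = B ^ p * (3 - q * p)⁻¹ := by
    rw [intervalIntegral.integral_const_mul, integral_rpow (Or.inl (by linarith)),
      Real.one_rpow, Real.zero_rpow (by linarith), sub_zero, one_div]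
    ring_nf
  rw [← hI, intervalIntegral.integral_of_le zero_le_one, intervalIntegral.integral_of_le zero_le_one]
  have hT0 : ∀ r, 0 ≤ Tmap k ρ r := fun r =>
    mul_nonneg hA0 (Real.rpow_nonneg (le_max_right _ _) _)
  refine integral_mono_of_nonneg ?_ ?_ ?_
  · exact Filter.Eventually.of_forall fun r =>
      mul_nonneg (sq_nonneg r) (Real.rpow_nonneg (hT0 r) p)
  · change IntegrableOn _ _ _
    rw [← intervalIntegrable_iff_integrableOn_Ioc_of_le zero_le_one]
    exact (intervalIntegral.intervalIntegrable_rpow' (by linarith)).const_mul _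
  · filter_upwards [ae_restrict_mem measurableSet_Ioc] with r hr
    have t1 : Tmap k ρ r ≤ B * r ^ (-q) := by
      unfold Tmap
      rw [← hqd, Real.rpow_neg hr.1.le, ← Real.inv_rpow hr.1.le]
      exact mul_le_mul hA (Real.rpow_le_rpow (le_max_right _ _) (U_upper h hr.1 hr.2) hq.le)
        (Real.rpow_nonneg (le_max_right _ _) _) hBp.le
    have t2 := Real.rpow_le_rpow (hT0 r) t1 hp0.le
    rw [Real.mul_rpow hBp.le (Real.rpow_nonneg hr.1.le _), ← Real.rpow_mul hr.1.le] at t2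
    have t3 : r ^ (2 - q * p) = r ^ 2 * r ^ (-q * p) := by
      rw [← Real.rpow_two, ← Real.rpow_add hr.1]; ring_nf
    rw [t3]
    calc r ^ 2 * Tmap k ρ r ^ p ≤ r ^ 2 * (B ^ p * r ^ (-q * p)) :=
          mul_le_mul_of_nonneg_left t2 (sq_nonneg r)
      _ = _ := by ring
end
end
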